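/- Let (A, 𝒜) be a measurable space, n a natural number, and let μ₁, …, μₙ and ν₁, …, νₙ be probability measures on A such that for all i ≠ j the pairs (μᵢ, μⱼ), (νᵢ, νⱼ), and (μᵢ, νⱼ) are mutually singular. Let w₁, …, wₙ and w′₁, …, w′ₙ be strictly positive reals with Σᵢ wᵢ·μᵢ = Σᵢ w′ᵢ·νᵢ as measures. Then wᵢ = w′ᵢ and μᵢ = νᵢ for every i. -/

import Mathlib

open MeasureTheory
open scoped NNReal

/-- A measure dominated by `β + σ` and mutually singular to `σ` is dominated by `β`. -/
theorem MeasureTheory.Measure.MutuallySingular.le_of_le_add {A : Type*} [MeasurableSpace A]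
    {α β σ : Measure A} (hσ : α ⟂ₘ σ) (h : α ≤ β + σ) : α ≤ β := by
  refine Measure.le_iff.2 fun E _ => ?_
  calc α E ≤ α (E ∩ hσ.nullSetᶜ) + α hσ.nullSet := by
        refine (measure_mono fun x hx => ?_).trans (measure_union_le _ _)
        by_cases hxs : x ∈ hσ.nullSet
        · exact Or.inr hxs
        · exact Or.inl ⟨hx, hxs⟩
    _ = α (E ∩ hσ.nullSetᶜ) := by rw [hσ.measure_nullSet, add_zero]
    _ ≤ β (E ∩ hσ.nullSetᶜ) + σ (E ∩ hσ.nullSetᶜ) := h _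
    _ = β (E ∩ hσ.nullSetᶜ) := by
        rw [measure_mono_null Set.inter_subset_right hσ.measure_compl_nullSet, add_zero]
    _ ≤ β E := measure_mono Set.inter_subset_left

theorem MeasureTheory.Measure.MutuallySingular.finsetSum_right {A ι : Type*}
    [MeasurableSpace A] {μ : Measure A} {ν : ι → Measure A} {s : Finset ι}
    (h : ∀ i ∈ s, μ ⟂ₘ ν i) : μ ⟂ₘ ∑ i ∈ s, ν i :=
  Finset.sum_induction ν (fun ρ => μ ⟂ₘ ρ) (fun _ _ => Measure.MutuallySingular.add_right)
    Measure.MutuallySingular.zero_right h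

/-- If one finite mixture is dominated by another and the components with different indices are
mutually singular, then the domination holds component by component. -/
theorem MeasureTheory.Measure.smul_le_smul_of_sum_le_sum {A ι : Type*} [MeasurableSpace A]
    [Fintype ι] {μ ν : ι → Measure A} {w w' : ι → ℝ≥0} (hμν : ∀ i j, i ≠ j → μ i ⟂ₘ ν j)
    (h : ∑ i, w i • μ i ≤ ∑ i, w' i • ν i) (i : ι) : w i • μ i ≤ w' i • ν i := by
  classical
  have hsing : w i • μ i ⟂ₘ ∑ j ∈ Finset.univ.erase i, w' j • ν j :=
    Measure.MutuallySingular.finsetSum_right fun j hj =>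
      (((hμν i j (Finset.ne_of_mem_erase hj).symm).smul_nnreal (w i)).symm.smul_nnreal (w' j)).symm
  refine hsing.le_of_le_add ?_
  rw [Finset.add_sum_erase _ (fun j => w' j • ν j) (Finset.mem_univ i)]
  refine le_trans ?_ h
  rw [← Finset.add_sum_erase _ (fun j => w j • μ j) (Finset.mem_univ i)]
  exact Measure.le_add_right le_rfl

/-- Non-overlapping mixtures with known (shared) index set: if two finite mixtures of
probability measures with pairwise mutually singular components (across and within the
two families) and strictly positive weights coincide, then the weights and the
components coincide index by index. -/
theorem mixture_identifiability
    {A : Type*} [MeasurableSpace A] {n : ℕ}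
    (μ ν : Fin n → Measure A)
    [∀ i, IsProbabilityMeasure (μ i)] [∀ i, IsProbabilityMeasure (ν i)]
    (hμμ : ∀ i j, i ≠ j → μ i ⟂ₘ μ j)
    (hνν : ∀ i j, i ≠ j → ν i ⟂ₘ ν j)
    (hμν : ∀ i j, i ≠ j → μ i ⟂ₘ ν j)
    (w w' : Fin n → ℝ≥0) (hw : ∀ i, 0 < w i) (hw' : ∀ i, 0 < w' i)
    (h : ∑ i, w i • μ i = ∑ i, w' i • ν i) :
    ∀ i, w i = w' i ∧ μ i = ν i := by
  intro i
  have heq : w i • μ i = w' i • ν i :=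
    le_antisymm (Measure.smul_le_smul_of_sum_le_sum hμν h.le i)
      (Measure.smul_le_smul_of_sum_le_sum (fun i j hij => (hμν j i hij.symm).symm) h.ge i)
  have hww : w i = w' i := by
    have huniv := congrArg (fun ρ : Measure A => ρ Set.univ) heq
    simpa only [Measure.smul_apply, measure_univ, ENNReal.smul_def, smul_eq_mul, mul_one,
      ENNReal.coe_inj] using huniv
  refine ⟨hww, ?_⟩
  rw [← hww] at heq
  simpa [smul_smul, inv_mul_cancel₀ (hw i).ne'] using congrArg (fun ρ => (w i)⁻¹ • ρ) heq
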